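/- arXiv:2409.15401 — 3 statements merged into one kernel-verified Lean document; each statement's English description precedes it below -/
import Mathlib

section
/- Holonomic approximation in the model case of sections of J¹(ℝ²,ℝ) along the segment K = [−1,1] × {0}: for all smooth functions f, F₁, F₂: ℝ² → ℝ and every ε > 0, there exist (i) a smooth map Φ: [0,1] × ℝ² → ℝ² such that Φ(0,·) is the identity, Φ(t,·) is a diffeomorphism of ℝ² for each t ∈ [0,1], and ‖Φ(t,p) − p‖ ≤ ε for all t and p; (ii) an open set U ⊆ ℝ² containing Φ(1, [−1,1] × {0}); and (iii) a smooth function g: U → ℝ such that for all (x,y) ∈ U one has |g(x,y) − f(x,y)| ≤ ε, |∂g/∂x(x,y) − F₁(x,y)| ≤ ε, and |∂g/∂y(x,y) − F₂(x,y)| ≤ ε. -/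
open Set

lemma hol_unif (a : ℝ × ℝ → ℝ) (ha : Continuous a) (e : ℝ) (he : 0 < e) :
    ∃ η > 0, ∀ x ∈ Icc (-1:ℝ) 1, ∀ y : ℝ, |y| < η → |a (x, 0) - a (x, y)| < e := by
  have hK : IsCompact (Icc (-1:ℝ) 1 ×ˢ Icc (-1:ℝ) 1) := isCompact_Icc.prod isCompact_Icc
  have hu := hK.uniformContinuousOn_of_continuous ha.continuousOn
  rw [Metric.uniformContinuousOn_iff] at hu
  obtain ⟨d, hd, h⟩ := hu e he
  refine ⟨min d 1, by positivity, fun x hx y hy => ?_⟩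
  have h1 : |y| < d := lt_of_lt_of_le hy (min_le_left _ _)
  have h2 : |y| < 1 := lt_of_lt_of_le hy (min_le_right _ _)
  have h3 := abs_lt.1 h2
  have := h (x, 0) ⟨hx, by norm_num, by norm_num⟩ (x, y) ⟨hx, h3.1.le, h3.2.le⟩
    (by rw [Prod.dist_eq]; simpa [Real.dist_eq, hd] using h1)
  simpa [Real.dist_eq] using this

lemma hol_bdd (u : ℝ → ℝ) (hu : Continuous u) :
    ∃ C : ℝ, 0 < C ∧ ∀ x ∈ Icc (-1:ℝ) 1, |u x| ≤ C := by
  obtain ⟨C, hC⟩ := (isCompact_Icc (a := (-1:ℝ)) (b := 1)).exists_bound_of_continuousOn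
    hu.continuousOn
  refine ⟨max C 1, by positivity, fun x hx => ?_⟩
  have := hC x hx
  rw [Real.norm_eq_abs] at this
  exact this.trans (le_max_left _ _)

/-- Partial derivatives of the explicit holonomic model along the curve `y = h x`. -/
lemma hol_deriv (f : ℝ × ℝ → ℝ) (G B h : ℝ → ℝ) (hf : Differentiable ℝ f)
    (hG : Differentiable ℝ G) (hB : Differentiable ℝ B) (hh : Differentiable ℝ h) (x : ℝ) :
    let g : ℝ × ℝ → ℝ := fun p => f p + G p.1 + B p.1 * (p.2 - h p.1)
    fderiv ℝ g (x, h x) (1, 0) = fderiv ℝ f (x, h x) (1, 0) + deriv G x - B x * deriv h x ∧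
    fderiv ℝ g (x, h x) (0, 1) = fderiv ℝ f (x, h x) (0, 1) + B x := by
  intro g
  have hg : Differentiable ℝ g := by
    have h1 : Differentiable ℝ (fun p : ℝ × ℝ => G p.1) := hG.comp differentiable_fst
    have h2 : Differentiable ℝ (fun p : ℝ × ℝ => B p.1) := hB.comp differentiable_fst
    have h3 : Differentiable ℝ (fun p : ℝ × ℝ => h p.1) := hh.comp differentiable_fst
    exact (hf.add h1).add (h2.mul (differentiable_snd.sub h3))
  have c1 : HasDerivAt (fun s : ℝ => (s, h x)) ((1:ℝ), (0:ℝ)) x :=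
    (hasDerivAt_id x).prodMk (hasDerivAt_const x _)
  have c2 : HasDerivAt (fun s : ℝ => (x, s)) ((0:ℝ), (1:ℝ)) (h x) :=
    (hasDerivAt_const _ _).prodMk (hasDerivAt_id _)
  have g1 := (hg (x, h x)).hasFDerivAt.comp_hasDerivAt x c1
  have g2 := (hg (x, h x)).hasFDerivAt.comp_hasDerivAt (h x) c2
  have f1 := (hf (x, h x)).hasFDerivAt.comp_hasDerivAt x c1
  have f2 := (hf (x, h x)).hasFDerivAt.comp_hasDerivAt (h x) c2
  constructor
  · have k := (f1.add (hG x).hasDerivAt).add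
      ((hB x).hasDerivAt.mul ((hasDerivAt_const x (h x)).sub (hh x).hasDerivAt))
    have := g1.unique k
    rw [this]; simp; ring
  · have k := (f2.add (hasDerivAt_const (h x) (G x))).add
      ((hasDerivAt_const (h x) (B x)).mul ((hasDerivAt_id (h x)).sub (hasDerivAt_const (h x) (h x))))
    have := g2.unique k
    rw [this]; simp

/-- Holonomic approximation in the model case of sections of `J¹(ℝ², ℝ)` along the segment
`K = [-1,1] × {0}`: given a section `(f, F₁, F₂)` of the 1-jet bundle and `ε > 0`, there is a
`C⁰`-small isotopy `Φ` of `ℝ²` through diffeomorphisms, an open neighborhood `U` of the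
wiggled segment `Φ(1, K)`, and a smooth function `g` on `U` whose 1-jet `(g, ∂g/∂x, ∂g/∂y)`
is `ε`-close to `(f, F₁, F₂)` on `U`. -/
theorem holonomic_approximation_model_case
    (f F₁ F₂ : ℝ × ℝ → ℝ)
    (hf : ContDiff ℝ (⊤ : ℕ∞) f) (hF₁ : ContDiff ℝ (⊤ : ℕ∞) F₁) (hF₂ : ContDiff ℝ (⊤ : ℕ∞) F₂)
    (ε : ℝ) (hε : 0 < ε) :
    ∃ Φ : ℝ → ℝ × ℝ → ℝ × ℝ,
      -- `Φ` is smooth jointly in the time and space variables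
      ContDiff ℝ (⊤ : ℕ∞) (fun q : ℝ × (ℝ × ℝ) => Φ q.1 q.2) ∧
      -- `Φ(0, ·)` is the identity
      Φ 0 = id ∧
      -- each `Φ(t, ·)`, `t ∈ [0,1]`, is a diffeomorphism of `ℝ²`
      (∀ t ∈ Icc (0:ℝ) 1, ∃ e : (ℝ × ℝ) ≃ (ℝ × ℝ),
        (∀ p, e p = Φ t p) ∧
        ContDiff ℝ (⊤ : ℕ∞) (e : (ℝ × ℝ) → (ℝ × ℝ)) ∧
        ContDiff ℝ (⊤ : ℕ∞) (e.symm : (ℝ × ℝ) → (ℝ × ℝ))) ∧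
      -- the isotopy moves points at most `ε`
      (∀ t ∈ Icc (0:ℝ) 1, ∀ p : ℝ × ℝ, ‖Φ t p - p‖ ≤ ε) ∧
      ∃ U : Set (ℝ × ℝ), IsOpen U ∧
        -- `U` is a neighborhood of the wiggled segment `Φ(1, K)`, `K = [-1,1] × {0}`
        Φ 1 '' (Icc (-1:ℝ) 1 ×ˢ ({0} : Set ℝ)) ⊆ U ∧
        ∃ g : ℝ × ℝ → ℝ, ContDiffOn ℝ (⊤ : ℕ∞) g U ∧
          ∀ p ∈ U,
            |g p - f p| ≤ ε ∧
            |fderiv ℝ g p (1, 0) - F₁ p| ≤ ε ∧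
            |fderiv ℝ g p (0, 1) - F₂ p| ≤ ε := by
  have hn : ((⊤ : ℕ∞) : WithTop ℕ∞) ≠ 0 := by simp
  have hfd : ContDiff ℝ (⊤ : ℕ∞) (fderiv ℝ f) := hf.fderiv_right (by simp)
  obtain ⟨a, ha_def⟩ : ∃ a : ℝ × ℝ → ℝ, a = fun p => F₁ p - fderiv ℝ f p (1, 0) := ⟨_, rfl⟩
  obtain ⟨b, hb_def⟩ : ∃ b : ℝ × ℝ → ℝ, b = fun p => F₂ p - fderiv ℝ f p (0, 1) := ⟨_, rfl⟩
  have ha : ContDiff ℝ (⊤ : ℕ∞) a := by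
    rw [ha_def]; exact hF₁.sub (hfd.clm_apply contDiff_const)
  have hb : ContDiff ℝ (⊤ : ℕ∞) b := by
    rw [hb_def]; exact hF₂.sub (hfd.clm_apply contDiff_const)
  obtain ⟨a0, ha0_def⟩ : ∃ a0 : ℝ → ℝ, a0 = fun x => a (x, 0) := ⟨_, rfl⟩
  obtain ⟨b0, hb0_def⟩ : ∃ b0 : ℝ → ℝ, b0 = fun x => b (x, 0) := ⟨_, rfl⟩
  have ha0 : ContDiff ℝ (⊤ : ℕ∞) a0 := by
    rw [ha0_def]; exact ha.comp (contDiff_id.prodMk contDiff_const)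
  have hb0 : ContDiff ℝ (⊤ : ℕ∞) b0 := by
    rw [hb0_def]; exact hb.comp (contDiff_id.prodMk contDiff_const)
  obtain ⟨C1, hC1, hC1'⟩ := hol_bdd a0 ha0.continuous
  obtain ⟨C2, hC2, hC2'⟩ := hol_bdd b0 hb0.continuous
  obtain ⟨C3, hC3, hC3'⟩ := hol_bdd (deriv a0) (ha0.continuous_deriv (by simp))
  obtain ⟨C4, hC4, hC4'⟩ := hol_bdd (deriv b0) (hb0.continuous_deriv (by simp))
  obtain ⟨η1, hη1, hη1'⟩ := hol_unif a ha.continuous (ε/4) (by positivity)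
  obtain ⟨η2, hη2, hη2'⟩ := hol_unif b hb.continuous (ε/4) (by positivity)
  obtain ⟨C, hC, k1, k2, k3, k4⟩ : ∃ C : ℝ, 0 < C ∧ C1 ≤ C ∧ C2 ≤ C ∧ C3 ≤ C ∧ C4 ≤ C :=
    ⟨C1 + C2 + C3 + C4, by positivity, by linarith, by linarith, by linarith, by linarith⟩
  obtain ⟨δ, hδ, d1, d2, d3, d4⟩ : ∃ δ : ℝ, 0 < δ ∧ δ ≤ ε ∧ δ < η1 ∧ δ < η2 ∧ C * δ ≤ ε / 4 := by
    refine ⟨min (min ε (η1/2)) (min (η2/2) (ε/4/C)), by positivity, ?_, ?_, ?_, ?_⟩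
    · exact (min_le_left _ _).trans (min_le_left _ _)
    · exact lt_of_le_of_lt ((min_le_left _ _).trans (min_le_right _ _)) (by linarith)
    · exact lt_of_le_of_lt ((min_le_right _ _).trans (min_le_left _ _)) (by linarith)
    · rw [mul_comm, ← le_div_iff₀ hC]
      exact (min_le_right _ _).trans (min_le_right _ _)
  obtain ⟨N, hN, n1, n2⟩ : ∃ N : ℝ, 0 < N ∧ C / (2 * N) ≤ ε / 4 ∧ 2 * C / (δ * N) ≤ ε / 4 := by
    refine ⟨2 * C / ε + 8 * C / (δ * ε), by positivity, ?_, ?_⟩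
    · rw [div_le_iff₀ (by positivity)]
      have : ε / 4 * (2 * (2 * C / ε + 8 * C / (δ * ε))) = C + 4 * C / δ := by
        field_simp
        ring
      rw [this]
      have : 0 < 4 * C / δ := by positivity
      linarith
    · rw [div_le_iff₀ (by positivity)]
      have : ε / 4 * (δ * (2 * C / ε + 8 * C / (δ * ε))) = 2 * C + C * δ / 2 := by
        field_simp
        ring
      rw [this]
      have : 0 < C * δ := by positivity
      linarith
  obtain ⟨h, hh_def⟩ : ∃ h : ℝ → ℝ, h = fun x => δ * Real.sin (N * x) := ⟨_, rfl⟩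
  obtain ⟨G, hG_def⟩ : ∃ G : ℝ → ℝ,
    G = fun x => b0 x * (δ * Real.sin (N * x)) - a0 x * (Real.sin (2 * N * x) / (2 * N)) := ⟨_, rfl⟩
  obtain ⟨B, hB_def⟩ : ∃ B : ℝ → ℝ,
    B = fun x => b0 x - 2 * a0 x / (δ * N) * Real.cos (N * x) := ⟨_, rfl⟩
  have hh : ContDiff ℝ (⊤ : ℕ∞) h := by rw [hh_def]; fun_prop
  have hG : ContDiff ℝ (⊤ : ℕ∞) G := by rw [hG_def]; fun_prop
  have hB : ContDiff ℝ (⊤ : ℕ∞) B := by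
    rw [hB_def]; simp only [div_eq_mul_inv]; fun_prop
  have habs : ∀ x, |h x| ≤ δ := by
    intro x
    rw [hh_def]
    simp only [abs_mul, abs_of_pos hδ]
    have := Real.abs_sin_le_one (N * x)
    nlinarith
  have hder_h : ∀ x, deriv h x = δ * (N * Real.cos (N * x)) := by
    intro x
    have e1 : HasDerivAt (fun x : ℝ => N * x) N x := by
      simpa using (hasDerivAt_id x).const_mul N
    have := (e1.sin.const_mul δ).deriv
    rw [hh_def, this]; ring
  have hder_G : ∀ x, deriv G x = deriv b0 x * h x + b0 x * deriv h x
      - deriv a0 x * (Real.sin (2 * N * x) / (2 * N)) - a0 x * Real.cos (2 * N * x) := by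
    intro x
    have e1 : HasDerivAt (fun x : ℝ => N * x) N x := by
      simpa using (hasDerivAt_id x).const_mul N
    have e2 : HasDerivAt (fun x : ℝ => 2 * N * x) (2 * N) x := by
      simpa using (hasDerivAt_id x).const_mul (2 * N)
    have ea := (ha0.differentiable hn x).hasDerivAt
    have eb := (hb0.differentiable hn x).hasDerivAt
    have := ((eb.mul (e1.sin.const_mul δ)).sub (ea.mul (e2.sin.div_const (2 * N)))).deriv
    rw [hder_h, hG_def]
    refine this.trans ?_
    rw [hh_def]
    field_simp
    ring
  have key : ∀ x, deriv G x - B x * deriv h x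
      = a0 x + deriv b0 x * h x - deriv a0 x * (Real.sin (2 * N * x) / (2 * N)) := by
    intro x
    rw [hder_G, hder_h, hB_def]
    have : Real.cos (2 * N * x) = 2 * Real.cos (N * x) ^ 2 - 1 := by
      rw [mul_assoc, Real.cos_two_mul]
    rw [this]
    field_simp
    ring
  have hsin : ∀ x, |Real.sin (2 * N * x) / (2 * N)| ≤ 1 / (2 * N) := by
    intro x
    rw [abs_div, abs_of_pos (show 0 < 2 * N by positivity)]
    gcongr
    exact Real.abs_sin_le_one _
  have small1 : ∀ u : ℝ, |u| ≤ C → ∀ x, |u * h x| ≤ ε / 4 := by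
    intro u hu x
    rw [abs_mul]
    exact (mul_le_mul hu (habs x) (abs_nonneg _) hC.le).trans d4
  have small2 : ∀ u : ℝ, |u| ≤ C → ∀ x, |u * (Real.sin (2 * N * x) / (2 * N))| ≤ ε / 4 := by
    intro u hu x
    rw [abs_mul]
    refine (mul_le_mul hu (hsin x) (abs_nonneg _) hC.le).trans ?_
    rwa [mul_one_div]
  obtain ⟨g, hg_def⟩ : ∃ g : ℝ × ℝ → ℝ,
    g = fun p => f p + G p.1 + B p.1 * (p.2 - h p.1) := ⟨_, rfl⟩
  have hg : ContDiff ℝ (⊤ : ℕ∞) g := by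
    have h1 : ContDiff ℝ (⊤ : ℕ∞) (fun p : ℝ × ℝ => G p.1) := hG.comp contDiff_fst
    have h2 : ContDiff ℝ (⊤ : ℕ∞) (fun p : ℝ × ℝ => B p.1) := hB.comp contDiff_fst
    have h3 : ContDiff ℝ (⊤ : ℕ∞) (fun p : ℝ × ℝ => h p.1) := hh.comp contDiff_fst
    rw [hg_def]
    exact (hf.add h1).add (h2.mul (contDiff_snd.sub h3))
  have hgd : Continuous (fderiv ℝ g) := hg.continuous_fderiv hn
  refine ⟨fun t p => (p.1, p.2 + t * h p.1), ?_, ?_, ?_, ?_,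
    {p | |g p - f p| < ε ∧ |fderiv ℝ g p (1, 0) - F₁ p| < ε ∧ |fderiv ℝ g p (0, 1) - F₂ p| < ε},
    ?_, ?_, g, hg.contDiffOn, fun p hp => ⟨hp.1.le, hp.2.1.le, hp.2.2.le⟩⟩
  · fun_prop
  · ext p <;> simp
  · intro t _
    refine ⟨⟨fun p => (p.1, p.2 + t * h p.1), fun p => (p.1, p.2 - t * h p.1), ?_, ?_⟩,
      fun p => rfl, ?_, ?_⟩
    · intro p; simp
    · intro p; simp
    · simp only [Equiv.coe_fn_mk]; fun_prop
    · simp only [Equiv.coe_fn_symm_mk]; fun_prop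
  · intro t ht p
    have e : ((p.1, p.2 + t * h p.1) : ℝ × ℝ) - p = (0, t * h p.1) := by ext <;> simp
    simp only [e, Prod.norm_def, norm_zero, Real.norm_eq_abs, abs_mul, abs_of_nonneg ht.1]
    refine max_le hε.le ?_
    have := habs p.1
    have := abs_nonneg (h p.1)
    nlinarith [ht.1, ht.2]
  · refine IsOpen.inter ?_ (IsOpen.inter ?_ ?_)
    · exact isOpen_lt (hg.continuous.sub hf.continuous).abs continuous_const
    · exact isOpen_lt ((hgd.clm_apply continuous_const).sub hF₁.continuous).abs continuous_const
    · exact isOpen_lt ((hgd.clm_apply continuous_const).sub hF₂.continuous).abs continuous_const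
  · rintro _ ⟨⟨x, y⟩, ⟨hx, hy⟩, rfl⟩
    simp only [mem_singleton_iff] at hx hy
    subst hy
    simp only [one_mul, zero_add, mem_setOf_eq]
    obtain ⟨p1, p2⟩ := hol_deriv f G B h (hf.differentiable hn) (hG.differentiable hn)
      (hB.differentiable hn) (hh.differentiable hn) x
    rw [← hg_def] at p1 p2
    have u1 := hη1' x hx (h x) ((habs x).trans_lt d2)
    have u2 := hη2' x hx (h x) ((habs x).trans_lt d3)
    have b1 := (hC1' x hx).trans k1
    have b2 := (hC2' x hx).trans k2
    have b3 := (hC3' x hx).trans k3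
    have b4 := (hC4' x hx).trans k4
    refine ⟨?_, ?_, ?_⟩
    · have s1 := abs_le.1 (small1 _ b2 x)
      have s2 := abs_le.1 (small2 _ b1 x)
      have : g (x, h x) - f (x, h x) = b0 x * h x - a0 x * (Real.sin (2 * N * x) / (2 * N)) := by
        rw [hg_def, hG_def, hh_def]; simp
      rw [this, abs_lt]
      constructor <;> linarith [s1.1, s1.2, s2.1, s2.2]
    · have s1 := abs_le.1 (small1 _ b4 x)
      have s2 := abs_le.1 (small2 _ b3 x)
      have u := abs_lt.1 u1
      have e1 : a0 x = a (x, 0) := by rw [ha0_def]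
      have e2 : a (x, h x) = F₁ (x, h x) - fderiv ℝ f (x, h x) (1, 0) := by rw [ha_def]
      have := key x
      rw [p1, abs_lt]
      constructor <;> linarith [s1.1, s1.2, s2.1, s2.2, u.1, u.2]
    · have u := abs_lt.1 u2
      have e1 : b0 x = b (x, 0) := by rw [hb0_def]
      have e2 : b (x, h x) = F₂ (x, h x) - fderiv ℝ f (x, h x) (0, 1) := by rw [hb_def]
      have e3 : B x = b0 x - 2 * a0 x / (δ * N) * Real.cos (N * x) := by rw [hB_def]
      have e4 : |2 * a0 x / (δ * N) * Real.cos (N * x)| ≤ ε / 4 := by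
        rw [abs_mul, abs_div, abs_mul, abs_of_pos (show 0 < δ * N by positivity), abs_two]
        refine le_trans ?_ n2
        have : 2 * |a0 x| / (δ * N) ≤ 2 * C / (δ * N) := by gcongr
        have hc := Real.abs_cos_le_one (N * x)
        have : 0 ≤ 2 * |a0 x| / (δ * N) := by positivity
        nlinarith
      have s := abs_le.1 e4
      rw [p2, abs_lt]
      constructor <;> linarith [s.1, s.2, u.1, u.2]
end

section
/- Let m > n ≥ 1 and let Q: ℝ^{m−n} → ℝ be a nondegenerate quadratic form, i.e., Q(z) = ⟨Az, z⟩ for some symmetric invertible linear map A: ℝ^{m−n} → ℝ^{m−n}. Define the stabilized wrinkle normal form W: ℝ^{m−n} × ℝ^{n−1} × ℝ → ℝ^{n−1} × ℝ by W(z,x,y) = (x, y³ + 3(‖x‖² − 1)y + Q(z)). Then the Fréchet derivative DW(z,x,y) is surjective if and only if it is not the case that both z = 0 and ‖x‖² + y² = 1. -/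
open scoped RealInnerProductSpace

/-- The stabilized wrinkle normal form
`W(z, x, y) = (x, y³ + 3(‖x‖² − 1)y + Q(z))` on `ℝ^{m−n} × ℝ^{n−1} × ℝ`,
where `Q(z) = ⟪A z, z⟫` for a linear map `A` on `ℝ^{m−n}`. -/
noncomputable def stabilizedWrinkleMap (m n : ℕ)
    (A : EuclideanSpace ℝ (Fin (m - n)) →L[ℝ] EuclideanSpace ℝ (Fin (m - n))) :
    EuclideanSpace ℝ (Fin (m - n)) × EuclideanSpace ℝ (Fin (n - 1)) × ℝ →
      EuclideanSpace ℝ (Fin (n - 1)) × ℝ :=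
  fun q => (q.2.1, q.2.2 ^ 3 + 3 * (‖q.2.1‖ ^ 2 - 1) * q.2.2 + ⟪A q.1, q.1⟫)

/-- For `m > n ≥ 1` and a nondegenerate quadratic form `Q(z) = ⟪A z, z⟫` (with `A`
symmetric and invertible), the derivative of the stabilized wrinkle normal form
`W(z, x, y) = (x, y³ + 3(‖x‖² − 1)y + Q(z))` at `(z, x, y)` is surjective if and only
if it is not the case that both `z = 0` and `‖x‖² + y² = 1`. -/
theorem stabilizedWrinkleMap_singular_locus (m n : ℕ) (hn : 1 ≤ n) (hmn : n < m)
    (A : EuclideanSpace ℝ (Fin (m - n)) →L[ℝ] EuclideanSpace ℝ (Fin (m - n)))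
    (hAsym : ∀ u v : EuclideanSpace ℝ (Fin (m - n)), ⟪A u, v⟫ = ⟪u, A v⟫)
    (hAinv : Function.Bijective A) :
    ∀ (z : EuclideanSpace ℝ (Fin (m - n))) (x : EuclideanSpace ℝ (Fin (n - 1))) (y : ℝ),
      Function.Surjective (fderiv ℝ (stabilizedWrinkleMap m n A) (z, x, y)) ↔
        ¬ (z = 0 ∧ ‖x‖ ^ 2 + y ^ 2 = 1) := by
  intro z x y
  have key : ∀ v : EuclideanSpace ℝ (Fin (m - n)) × EuclideanSpace ℝ (Fin (n - 1)) × ℝ,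
      fderiv ℝ (stabilizedWrinkleMap m n A) (z, x, y) v =
        (v.2.1, 3 * (‖x‖ ^ 2 + y ^ 2 - 1) * v.2.2 + 6 * y * ⟪x, v.2.1⟫ + 2 * ⟪A z, v.1⟫) := by
    intro v
    have h1 : HasFDerivAt
        (fun q : EuclideanSpace ℝ (Fin (m - n)) × EuclideanSpace ℝ (Fin (n - 1)) × ℝ => q.1)
        (ContinuousLinearMap.fst ℝ _ _) (z, x, y) := hasFDerivAt_fst
    have h2 : HasFDerivAt
        (fun q : EuclideanSpace ℝ (Fin (m - n)) × EuclideanSpace ℝ (Fin (n - 1)) × ℝ => q.2)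
        (ContinuousLinearMap.snd ℝ _ _) (z, x, y) := hasFDerivAt_snd
    have hx := h2.fst
    have hy := h2.snd
    have hA := (A.hasFDerivAt (x := z)).comp (z, x, y) h1
    have h := hx.prodMk (((hy.pow 3).add
      (((hx.norm_sq.sub_const 1).const_mul 3).mul hy)).add (hA.inner ℝ h1))
    have h' : HasFDerivAt (stabilizedWrinkleMap m n A) _ (z, x, y) := h
    rw [h'.fderiv]
    have hs : ⟪z, A v.1⟫ = ⟪A z, v.1⟫ := (hAsym z v.1).symm
    ext i
    · simp
    · have hs' : ⟪A v.1, z⟫ = ⟪A z, v.1⟫ := by rw [← hs, real_inner_comm]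
      simp [fderivInnerCLM_apply, hs']
      ring
  constructor
  · rintro hsurj ⟨rfl, h⟩
    obtain ⟨v, hv⟩ := hsurj (0, 1)
    rw [key] at hv
    have e1 : v.2.1 = 0 := congrArg Prod.fst hv
    have e2 := congrArg Prod.snd hv
    simp [e1, h] at e2
  · rintro h ⟨a, b⟩
    by_cases hz : z = 0
    · have hc : ‖x‖ ^ 2 + y ^ 2 - 1 ≠ 0 := fun hc => h ⟨hz, by linarith⟩
      refine ⟨(0, a, (b - 6 * y * ⟪x, a⟫) / (3 * (‖x‖ ^ 2 + y ^ 2 - 1))), ?_⟩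
      rw [key]
      ext i
      · rfl
      · simp only [inner_zero_right]
        field_simp
        ring
    · have hAz : A z ≠ 0 := fun h0 => hz (hAinv.1 (by rw [h0, map_zero]))
      have hc : ⟪A z, A z⟫ ≠ 0 := inner_self_ne_zero.mpr hAz
      refine ⟨(((b - 6 * y * ⟪x, a⟫) / (2 * ⟪A z, A z⟫)) • A z, a, 0), ?_⟩
      rw [key]
      ext i
      · rfl
      · simp only [real_inner_smul_right]
        field_simp
        ring
end

section
/- Let n ≥ 1 and define η: ℝ^{n−1} × ℝ → ℝ^{n−1} × ℝ × ℝ by η(x,y) = (x, y³ + 3(‖x‖² − 1)y, ∫₀^y (z² + ‖x‖² − 1)² dz). Then η is smooth and is a topological embedding of ℝⁿ into ℝ^{n+1}: it is injective and a homeomorphism onto its image. -/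
/-- The normal form of an embedded wrinkle:
`η(x, y) = (x, y³ + 3(‖x‖² − 1)y, ∫₀^y (z² + ‖x‖² − 1)² dz)`
from `ℝ^{n−1} × ℝ` to `ℝ^{n−1} × ℝ × ℝ`. -/
noncomputable def wrinkledEmbeddingNormalForm (n : ℕ) :
    EuclideanSpace ℝ (Fin (n - 1)) × ℝ → EuclideanSpace ℝ (Fin (n - 1)) × ℝ × ℝ :=
  fun p => (p.1, p.2 ^ 3 + 3 * (‖p.1‖ ^ 2 - 1) * p.2,
    ∫ z in (0:ℝ)..p.2, (z ^ 2 + ‖p.1‖ ^ 2 - 1) ^ 2)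

/-- Closed form of the integral coordinate. -/
lemma wrinkle_integral (c y : ℝ) :
    ∫ z in (0:ℝ)..y, (z ^ 2 + c - 1) ^ 2
      = y ^ 5 / 5 + 2 * (c - 1) * y ^ 3 / 3 + (c - 1) ^ 2 * y := by
  have h : ∀ z ∈ Set.uIcc (0:ℝ) y, HasDerivAt
      (fun y : ℝ => y ^ 5 / 5 + 2 * (c - 1) * y ^ 3 / 3 + (c - 1) ^ 2 * y)
      ((z ^ 2 + c - 1) ^ 2) z := by
    intro z _
    have := ((((hasDerivAt_id z).pow 5).div_const 5).add
      ((((hasDerivAt_id z).pow 3).const_mul (2 * (c - 1))).div_const 3)).add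
      ((hasDerivAt_id z).const_mul ((c - 1) ^ 2))
    refine HasDerivAt.congr_deriv this ?_
    simp only [id, Nat.cast_ofNat]
    norm_num
    ring
  rw [intervalIntegral.integral_eq_sub_of_hasDerivAt h
    (Continuous.intervalIntegrable (by fun_prop) _ _)]
  ring

/-- Quantitative strict monotonicity of the last coordinate in `y`. -/
lemma wrinkle_bound (c a b : ℝ) :
    |b - a| ^ 5 ≤ 180 * |(b ^ 5 / 5 + 2 * c * b ^ 3 / 3 + c ^ 2 * b)
      - (a ^ 5 / 5 + 2 * c * a ^ 3 / 3 + c ^ 2 * a)| := by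
  have e : (b ^ 5 / 5 + 2 * c * b ^ 3 / 3 + c ^ 2 * b)
      - (a ^ 5 / 5 + 2 * c * a ^ 3 / 3 + c ^ 2 * a)
      = (b - a) * ((c + (a ^ 2 + a * b + b ^ 2) / 3) ^ 2
        + (a + b) ^ 2 * (b - a) ^ 2 / 12 + (b - a) ^ 4 / 180) := by ring
  rw [e, abs_mul, abs_of_nonneg (a := _ + _) (by positivity)]
  have h4 : |b - a| ^ 4 = (b - a) ^ 4 := by
    rw [← abs_pow, abs_of_nonneg (by positivity)]
  have : |b - a| ^ 5 = |b - a| * (b - a) ^ 4 := by rw [← h4]; ring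
  rw [this]
  have h1 : (0:ℝ) ≤ (c + (a ^ 2 + a * b + b ^ 2) / 3) ^ 2
        + (a + b) ^ 2 * (b - a) ^ 2 / 12 := by positivity
  nlinarith [mul_nonneg (abs_nonneg (b - a)) h1]

lemma wrinkle_eq (n : ℕ) : wrinkledEmbeddingNormalForm n = fun p =>
    (p.1, p.2 ^ 3 + 3 * (‖p.1‖ ^ 2 - 1) * p.2,
      p.2 ^ 5 / 5 + 2 * (‖p.1‖ ^ 2 - 1) * p.2 ^ 3 / 3 + (‖p.1‖ ^ 2 - 1) ^ 2 * p.2) := by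
  funext p
  simp only [wrinkledEmbeddingNormalForm, wrinkle_integral]

/-- The normal form `η(x, y) = (x, y³ + 3(‖x‖² − 1)y, ∫₀^y (z² + ‖x‖² − 1)² dz)` of an
embedded wrinkle is smooth and is a topological embedding of `ℝⁿ` into `ℝ^{n+1}`: it is
injective and a homeomorphism onto its image. -/
theorem wrinkledEmbeddingNormalForm_topological_embedding (n : ℕ) (hn : 1 ≤ n) :
    ContDiff ℝ (⊤ : ℕ∞) (wrinkledEmbeddingNormalForm n) ∧
    Function.Injective (wrinkledEmbeddingNormalForm n) ∧
    Topology.IsEmbedding (wrinkledEmbeddingNormalForm n) := by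
  rw [wrinkle_eq]
  have hs : ContDiff ℝ (⊤ : ℕ∞) (fun p : EuclideanSpace ℝ (Fin (n - 1)) × ℝ =>
    (p.1, p.2 ^ 3 + 3 * (‖p.1‖ ^ 2 - 1) * p.2,
      p.2 ^ 5 / 5 + 2 * (‖p.1‖ ^ 2 - 1) * p.2 ^ 3 / 3 + (‖p.1‖ ^ 2 - 1) ^ 2 * p.2)) := by
    have hN : ContDiff ℝ (⊤ : ℕ∞) (fun p : EuclideanSpace ℝ (Fin (n - 1)) × ℝ => ‖p.1‖ ^ 2) :=
      contDiff_fst.norm_sq ℝ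
    fun_prop
  have hi : Function.Injective (fun p : EuclideanSpace ℝ (Fin (n - 1)) × ℝ =>
    (p.1, p.2 ^ 3 + 3 * (‖p.1‖ ^ 2 - 1) * p.2,
      p.2 ^ 5 / 5 + 2 * (‖p.1‖ ^ 2 - 1) * p.2 ^ 3 / 3 + (‖p.1‖ ^ 2 - 1) ^ 2 * p.2)) := by
    rintro ⟨x, a⟩ ⟨x', b⟩ h
    simp only [Prod.mk.injEq] at h
    obtain ⟨rfl, -, h⟩ := h
    have hb := wrinkle_bound (‖x‖ ^ 2 - 1) b a
    rw [h, sub_self, abs_zero, mul_zero] at hb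
    have h0 : |a - b| = 0 :=
      pow_eq_zero_iff (n := 5) (by norm_num) |>.1 (le_antisymm hb (by positivity))
    rw [sub_eq_zero.1 (abs_eq_zero.1 h0)]
  refine ⟨hs, hi, ⟨?_, hi⟩⟩
  rw [Topology.isInducing_iff_nhds]
  rintro ⟨x0, y0⟩
  refine le_antisymm (hs.continuous.tendsto _).le_comap ?_
  set f := (fun p : EuclideanSpace ℝ (Fin (n - 1)) × ℝ =>
    (p.1, p.2 ^ 3 + 3 * (‖p.1‖ ^ 2 - 1) * p.2,
      p.2 ^ 5 / 5 + 2 * (‖p.1‖ ^ 2 - 1) * p.2 ^ 3 / 3 + (‖p.1‖ ^ 2 - 1) ^ 2 * p.2)) with hf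
  set l := Filter.comap f (nhds (f (x0, y0))) with hl
  have ht : Filter.Tendsto f l (nhds (f (x0, y0))) := Filter.tendsto_comap
  have h1 : Filter.Tendsto (fun p : EuclideanSpace ℝ (Fin (n - 1)) × ℝ => p.1) l (nhds x0) :=
    (continuous_fst.tendsto _).comp ht
  have h3 : Filter.Tendsto (fun p => (f p).2.2) l (nhds (f (x0, y0)).2.2) :=
    ((continuous_snd.comp continuous_snd).tendsto _).comp ht
  have h4 : Filter.Tendsto (fun p : EuclideanSpace ℝ (Fin (n - 1)) × ℝ => (f (p.1, y0)).2.2) l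
      (nhds (f (x0, y0)).2.2) :=
    ((continuous_snd.comp continuous_snd).tendsto _).comp
      ((hs.continuous.tendsto (x0, y0)).comp (h1.prodMk_nhds tendsto_const_nhds))
  have h5 : Filter.Tendsto (fun p : EuclideanSpace ℝ (Fin (n - 1)) × ℝ => |p.2 - y0| ^ 5) l
      (nhds 0) := by
    have h6 := ((h3.sub h4).abs).const_mul 180
    rw [sub_self, abs_zero, mul_zero] at h6
    exact squeeze_zero (fun p => by positivity)
      (fun p => wrinkle_bound (‖p.1‖ ^ 2 - 1) y0 p.2) h6
  have h2 : Filter.Tendsto (fun p : EuclideanSpace ℝ (Fin (n - 1)) × ℝ => p.2) l (nhds y0) := by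
    rw [Metric.tendsto_nhds]
    intro ε hε
    filter_upwards [h5.eventually (gt_mem_nhds (pow_pos hε 5))] with p hp
    rw [Real.dist_eq]
    exact lt_of_pow_lt_pow_left₀ 5 hε.le hp
  exact (h1.prodMk_nhds h2 : Filter.Tendsto id l _)
end
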